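/- arXiv:0905.3098 — 2 statements merged into one kernel-verified Lean document; each statement's English description precedes it below -/
import Mathlib

section
/- Let (X,T) be a minimal distal system and d ≥ 1. For every x ∈ X, the set Q^[d](x) = { y ∈ Q^[d](X) : y_∅ = x } is exactly the closed orbit of the diagonal point x^[d] = (x,…,x) under the group F^[d] generated by the face transformations. -/
open Filter Topology

noncomputable section

def dotP {d : ℕ} (n : Fin d → ℤ) (ε : Fin d → Bool) : ℤ :=
  ∑ i, if ε i then n i else 0

def vertex0 (d : ℕ) : Fin d → Bool := fun _ => false

def cubeQ (X : Type*) [TopologicalSpace X] (T : X ≃ₜ X) (d : ℕ) :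
    Set ((Fin d → Bool) → X) :=
  closure {y | ∃ (x : X) (n : Fin d → ℤ), y = fun ε => (T.toEquiv ^ dotP n ε) x}

/-- The face transformation `T_j^[d]`. -/
def faceT {X : Type*} (T : Equiv.Perm X) (d : ℕ) (j : Fin d) :
    Equiv.Perm ((Fin d → Bool) → X) :=
  Equiv.piCongrRight fun ε => if ε j then T else Equiv.refl X

/-- The diagonal transformation `T^[d]`. -/
def diagT {X : Type*} (T : Equiv.Perm X) (d : ℕ) :
    Equiv.Perm ((Fin d → Bool) → X) :=
  Equiv.piCongrRight fun _ => T

/-- The face group `F^[d]`. -/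
def faceGroup {X : Type*} (T : Equiv.Perm X) (d : ℕ) :
    Subgroup (Equiv.Perm ((Fin d → Bool) → X)) :=
  Subgroup.closure (Set.range (faceT T d))

/-- The parallelepiped group `G^[d]`. -/
def cubeGroup {X : Type*} (T : Equiv.Perm X) (d : ℕ) :
    Subgroup (Equiv.Perm ((Fin d → Bool) → X)) :=
  Subgroup.closure (insert (diagT T d) (Set.range (faceT T d)))

attribute [local instance] Ultrafilter.add Ultrafilter.addSemigroup

/-- A minimal distal `ℤ`-flow on a metric space. -/
structure MDFlow {X : Type*} [MetricSpace X] (φ : ℤ → X → X) : Prop where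
  zero : ∀ x, φ 0 x = x
  add : ∀ m n x, φ (m + n) x = φ m (φ n x)
  cont : ∀ n, Continuous (φ n)
  dist : ∀ x y : X, x ≠ y → ∃ δ > 0, ∀ n : ℤ, δ ≤ dist (φ n x) (φ n y)
  min : ∀ x : X, Dense (Set.range fun n : ℤ => φ n x)

/-- The limit of `φ (c m) z` along an ultrafilter. -/
def Rlim {X M : Type*} [TopologicalSpace X] (φ : ℤ → X → X) (c : M → ℤ) (p : Ultrafilter M)
    (z : X) : X :=
  (p.map (fun m => φ (c m) z)).lim

theorem Rlim_tendsto {X M : Type*} [MetricSpace X] [CompactSpace X] (φ : ℤ → X → X) (c : M → ℤ)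
    (p : Ultrafilter M) (z : X) :
    Tendsto (fun m => φ (c m) z) p (𝓝 (Rlim φ c p z)) :=
  Ultrafilter.le_nhds_lim (p.map (fun m => φ (c m) z))

theorem Rlim_eq {X M : Type*} [MetricSpace X] [CompactSpace X] {φ : ℤ → X → X} {c : M → ℤ}
    {p : Ultrafilter M} {z w : X} (h : Tendsto (fun m => φ (c m) z) p (𝓝 w)) :
    Rlim φ c p z = w :=
  tendsto_nhds_unique (Rlim_tendsto φ c p z) h

theorem Rlim_map {X M N : Type*} [MetricSpace X] [CompactSpace X] (φ : ℤ → X → X) (c : M → ℤ)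
    (ρ : N → M) (p : Ultrafilter N) (z : X) :
    Rlim φ c (p.map ρ) z = Rlim φ (fun n => c (ρ n)) p z := by
  apply Rlim_eq
  exact Rlim_tendsto φ (fun n => c (ρ n)) p z

section flow
variable {X : Type*} [MetricSpace X] [CompactSpace X] {φ : ℤ → X → X}

theorem Rlim_add {M : Type*} [AddCommGroup M] (hφ : MDFlow φ) (c : M →+ ℤ)
    (p q : Ultrafilter M) (z : X) :
    Rlim φ c (p + q) z = Rlim φ c p (Rlim φ c q z) := by
  have h1 := Rlim_tendsto φ c p (Rlim φ c q z)
  have h2 := Rlim_tendsto φ c q z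
  apply Rlim_eq
  rw [(closed_nhds_basis _).tendsto_right_iff]
  rintro s ⟨hs, hsc⟩
  rw [Ultrafilter.eventually_add]
  obtain ⟨o, hos, ho, hzo⟩ := mem_nhds_iff.1 hs
  filter_upwards [h1 (ho.mem_nhds hzo)] with m hm
  have h3 : Tendsto (fun m' => φ (c m) (φ (c m') z)) q (𝓝 (φ (c m) (Rlim φ c q z))) :=
    ((hφ.cont (c m)).tendsto _).comp h2
  filter_upwards [h3 (ho.mem_nhds hm)] with m' hm'
  rw [map_add, hφ.add]
  exact hos hm'

theorem Rlim_inj {M : Type*} (hφ : MDFlow φ) (c : M → ℤ)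
    (p : Ultrafilter M) {z w : X} (h : Rlim φ c p z = Rlim φ c p w) : z = w := by
  by_contra hne
  obtain ⟨δ, hδ, H⟩ := hφ.dist z w hne
  have h1 := (Rlim_tendsto φ c p z).dist (Rlim_tendsto φ c p w)
  rw [h, dist_self] at h1
  exact absurd (ge_of_tendsto' h1 fun m => H (c m)) (not_le.2 hδ)

theorem Rlim_idem {M : Type*} [AddCommGroup M] (hφ : MDFlow φ) (c : M →+ ℤ)
    (p : Ultrafilter M) (hp : p + p = p) (z : X) : Rlim φ c p z = z := by
  apply Rlim_inj hφ c p
  rw [← Rlim_add hφ, hp]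

theorem Rlim_inv {M : Type*} [AddCommGroup M] (hφ : MDFlow φ) (p : Ultrafilter M) :
    ∃ q : Ultrafilter M, ∀ (c : M →+ ℤ) (z : X),
      Rlim φ c q (Rlim φ c p z) = z ∧ Rlim φ c p (Rlim φ c q z) = z := by
  obtain ⟨e, ⟨q, rfl⟩, he⟩ := exists_idempotent_in_compact_add_subsemigroup
    (M := Ultrafilter M) Ultrafilter.continuous_add_left (Set.range fun q => q + p)
    ⟨_, ⟨p, rfl⟩⟩ (isCompact_range (Ultrafilter.continuous_add_left p)) (by
      rintro _ ⟨a, rfl⟩ _ ⟨b, rfl⟩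
      exact ⟨a + p + b, by simp only [add_assoc]⟩)
  refine ⟨q, fun c z => ?_⟩
  have h : ∀ z, Rlim φ c q (Rlim φ c p z) = z := fun z => by
    rw [← Rlim_add hφ]; exact Rlim_idem hφ c _ he z
  exact ⟨h z, Rlim_inj hφ c q (h _)⟩

/-- Points approximated along a family of weights are ultrafilter limits. -/
theorem exists_Rlim {M E : Type*} (c : E → M → ℤ) (y w : E → X) (B : M → Prop)
    (h : ∀ U : E → Set X, (∀ e, U e ∈ 𝓝 (w e)) → ∃ m, B m ∧ ∀ e, φ (c e m) (y e) ∈ U e) :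
    ∃ p : Ultrafilter M, (∀ᶠ m in p, B m) ∧ ∀ e, Rlim φ (c e) p (y e) = w e := by
  let f : M → E → X := fun m e => φ (c e m) (y e)
  have hne : (comap f (𝓝 w) ⊓ 𝓟 {m | B m}).NeBot := by
    rw [inf_principal_neBot_iff]
    rintro u ⟨t, ht, htu⟩
    rw [nhds_pi, Filter.mem_pi] at ht
    obtain ⟨I, -, v, hv, hvt⟩ := ht
    obtain ⟨m, hB, hm⟩ := h v hv
    exact ⟨m, htu (hvt fun e _ => hm e), hB⟩
  refine ⟨Ultrafilter.of (comap f (𝓝 w) ⊓ 𝓟 {m | B m}), ?_, fun e => Rlim_eq ?_⟩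
  · exact ((Ultrafilter.of_le (comap f (𝓝 w) ⊓ 𝓟 {m | B m})).trans inf_le_right)
      (mem_principal_self _)
  · have h1 : Tendsto f (Ultrafilter.of (comap f (𝓝 w) ⊓ 𝓟 {m | B m})) (𝓝 w) :=
      tendsto_comap.mono_left ((Ultrafilter.of_le _).trans inf_le_left)
    exact (tendsto_pi_nhds.1 h1) e

/-- Partial sums over a finite set, as a homomorphism. -/
def wF {ι : Type*} (ε : Finset ι) : (ι → ℤ) →+ ℤ where
  toFun n := ∑ i ∈ ε, n i
  map_zero' := by simp
  map_add' := by intro a b; simp [Finset.sum_add_distrib]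

/-- The weights of the full cube group. -/
def wG {ι : Type*} (ε : Finset ι) : (ℤ × (ι → ℤ)) →+ ℤ where
  toFun g := g.1 + ∑ i ∈ ε, g.2 i
  map_zero' := by simp
  map_add' := by intro a b; simp [Finset.sum_add_distrib]; ring

/-- Openness: corners near the diagonal corner can be completed near `w`. -/
theorem corner_open {ι : Type*} [DecidableEq ι] (hφ : MDFlow φ) (x w : X) (α : Finset ι)
    (p : Ultrafilter (ℤ × (ι → ℤ))) (hp : ∀ ε, ε ⊂ α → Rlim φ (wG ε) p x = x)
    (hpw : Rlim φ (wG α) p x = w) (U V : Set X) (hU : U ∈ 𝓝 x) (hV : V ∈ 𝓝 w) :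
    ∃ U0 : Set X, IsOpen U0 ∧ x ∈ U0 ∧ U0 ⊆ U ∧
      ∀ g : ℤ × (ι → ℤ), (∀ ε, ε ⊂ α → φ (wG ε g) x ∈ U0) →
        ∃ h : Ultrafilter (ℤ × (ι → ℤ)), (∀ ε, ε ⊂ α → Rlim φ (wG ε) h x = x) ∧
          Rlim φ (wG α) h x ∈ φ (wG α g) ⁻¹' V := by
  by_contra! hcon
  obtain ⟨P, hPB, hP⟩ := exists_Rlim (φ := φ) (M := ℤ × (ι → ℤ)) (E := {ε : Finset ι // ε ⊂ α})
    (fun e => wG e.1) (fun _ => x) (fun _ => x)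
    (fun g => ∀ h : Ultrafilter (ℤ × (ι → ℤ)), (∀ ε, ε ⊂ α → Rlim φ (wG ε) h x = x) →
          Rlim φ (wG α) h x ∉ φ (wG α g) ⁻¹' V) (by
      intro W hW
      have hfin : Finite {ε : Finset ι // ε ⊂ α} :=
        Set.Finite.to_subtype (α.ssubsets.finite_toSet.subset fun ε hε => by
          simpa using (show ε ⊂ α from hε))
      obtain ⟨U0, h1, h2, h3⟩ := mem_nhds_iff.1
        (inter_mem hU ((Filter.iInter_mem (f := 𝓝 x)).2 hW))
      obtain ⟨g, hg, hg'⟩ := hcon U0 h2 h3 (fun z hz => (h1 hz).1)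
      exact ⟨g, hg', fun e => Set.mem_iInter.1 (h1 (hg e.1 e.2)).2 e⟩)
  obtain ⟨q, hq⟩ := Rlim_inv hφ P
  have hlim := Rlim_tendsto φ (wG α) P (Rlim φ (wG α) (q + p) x)
  have e1 : Rlim φ (wG α) P (Rlim φ (wG α) (q + p) x) = w := by
    rw [Rlim_add hφ, (hq _ _).2, hpw]
  rw [e1] at hlim
  obtain ⟨g, hg1, hg2⟩ := (hPB.and (hlim hV)).exists
  refine hg1 (q + p) (fun ε hε => ?_) hg2
  rw [Rlim_add hφ, hp ε hε]
  have := (hq (wG ε) x).1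
  rwa [hP ⟨ε, hε⟩] at this

/-- One step of the construction of the IP sequence. -/
theorem corner_step {ι : Type*} [DecidableEq ι] (hφ : MDFlow φ) (x : X) (κ : Finset ι) (j : ι)
    (hj : j ∉ κ) (U0 V : Set X) (hV : IsOpen V)
    (hO : ∀ g : ℤ × (ι → ℤ), (∀ ε, ε ⊂ insert j κ → φ (wG ε g) x ∈ U0) →
        ∃ h : Ultrafilter (ℤ × (ι → ℤ)), (∀ ε, ε ⊂ insert j κ → Rlim φ (wG ε) h x = x) ∧
          Rlim φ (wG (insert j κ)) h x ∈ φ (wG (insert j κ) g) ⁻¹' V)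
    (W : Set X) (hW : IsOpen W) (hWne : W.Nonempty) (t : ι → ℤ)
    (ht : ∀ z ∈ W, ∀ ε ⊆ κ, φ (wF ε t) z ∈ U0) :
    ∃ p : ι → ℤ, (∃ u, ∀ ε ⊆ κ, φ (wF ε p) u ∈ W) ∧
      ∃ u, (∀ ε, ε ⊂ κ → φ (wF ε p) u ∈ W) ∧ φ (wF κ (p + t)) u ∈ V := by
  obtain ⟨_, ⟨k, rfl⟩, hk⟩ := (hφ.min x).exists_mem_open hW hWne
  simp only at hk
  have hwg : ∀ ε ⊆ insert j κ, wG ε (k, fun i => if i = j then 0 else t i)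
      = wF (ε.erase j) t + k := by
    intro ε hε
    simp only [wG, wF, AddMonoidHom.coe_mk, ZeroHom.coe_mk]
    rw [add_comm]
    congr 1
    by_cases h : j ∈ ε
    · rw [← Finset.add_sum_erase _ _ h]
      simp only [if_true, zero_add]
      exact Finset.sum_congr rfl fun i hi => if_neg (Finset.ne_of_mem_erase hi)
    · rw [Finset.erase_eq_of_notMem h]
      exact Finset.sum_congr rfl fun i hi => if_neg (by rintro rfl; exact h hi)
  obtain ⟨h, h1, h2⟩ := hO (k, fun i => if i = j then 0 else t i) (by
    intro ε hε
    rw [hwg ε hε.subset, hφ.add]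
    exact ht _ hk _ (by
      intro i hi
      rw [Finset.mem_erase] at hi
      exact (Finset.mem_insert.1 (hε.subset hi.2)).resolve_left hi.1))
  have hfin : (Set.Finite {ε : Finset ι | ε ⊂ insert j κ}) :=
    (insert j κ).ssubsets.finite_toSet.subset fun ε hε => by simpa using hε
  have ev1 : ∀ᶠ m in (h : Filter (ℤ × (ι → ℤ))), ∀ ε ∈ {ε : Finset ι | ε ⊂ insert j κ},
      φ k (φ (wG ε m) x) ∈ W := by
    rw [Filter.eventually_all_finite hfin]
    intro ε hε
    have hl := Rlim_tendsto φ (wG ε) h x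
    rw [h1 ε hε] at hl
    exact (((hφ.cont k).tendsto x).comp hl) (hW.mem_nhds hk)
  have ev2 : ∀ᶠ m in (h : Filter (ℤ × (ι → ℤ))), φ (wG (insert j κ) m) x ∈
      φ (wG (insert j κ) (k, fun i => if i = j then 0 else t i)) ⁻¹' V :=
    (Rlim_tendsto φ (wG (insert j κ)) h x) ((hV.preimage (hφ.cont _)).mem_nhds h2)
  obtain ⟨⟨l, n⟩, hm1, hm2⟩ := (ev1.and ev2).exists
  refine ⟨n, ⟨φ (k + l) x, fun ε hε => ?_⟩, φ (k + l + n j) x, fun ε hε => ?_, ?_⟩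
  · have := hm1 ε (Finset.ssubset_of_subset_of_ssubset hε (Finset.ssubset_insert hj))
    rw [← hφ.add] at this ⊢
    convert this using 2
    simp [wG, wF]; ring
  · have hjε : j ∉ ε := fun h' => hj (hε.subset h')
    have := hm1 (insert j ε) (by
      refine (Finset.insert_subset_insert j hε.subset).ssubset_of_ne ?_
      intro he
      apply hε.ne
      have := congrArg (fun s => s.erase j) he
      simpa [hjε, hj] using this)
    rw [← hφ.add] at this ⊢
    convert this using 2
    simp [wG, wF, hjε]; ring
  · rw [Set.mem_preimage, ← hφ.add, hwg _ subset_rfl] at hm2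
    rw [← hφ.add]
    convert hm2 using 2
    simp [wG, wF, hj, Finset.sum_add_distrib]; ring

/-- The IP sequence. -/
theorem corner_stream {ι : Type*} [DecidableEq ι] (hφ : MDFlow φ) (x : X) (κ : Finset ι) (j : ι)
    (hj : j ∉ κ) (U0 V : Set X) (hU0 : IsOpen U0) (hx : x ∈ U0) (hV : IsOpen V)
    (hO : ∀ g : ℤ × (ι → ℤ), (∀ ε, ε ⊂ insert j κ → φ (wG ε g) x ∈ U0) →
        ∃ h : Ultrafilter (ℤ × (ι → ℤ)), (∀ ε, ε ⊂ insert j κ → Rlim φ (wG ε) h x = x) ∧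
          Rlim φ (wG (insert j κ)) h x ∈ φ (wG (insert j κ) g) ⁻¹' V) :
    ∃ a : Stream' (ι → ℤ), ∀ m ∈ Hindman.FS a,
      ∃ u, (∀ ε, ε ⊂ κ → φ (wF ε m) u ∈ U0) ∧ φ (wF κ m) u ∈ V := by
  let St := {σ : Set X × (ι → ℤ) // IsOpen σ.1 ∧ σ.1.Nonempty ∧
    ∀ z ∈ σ.1, ∀ ε ⊆ κ, φ (wF ε σ.2) z ∈ U0}
  have step : ∀ σ : St, ∃ p : ι → ℤ, (∃ u, ∀ ε ⊆ κ, φ (wF ε p) u ∈ σ.1.1) ∧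
      ∃ u, (∀ ε, ε ⊂ κ → φ (wF ε p) u ∈ σ.1.1) ∧ φ (wF κ (p + σ.1.2)) u ∈ V := fun σ =>
    corner_step hφ x κ j hj U0 V hV hO σ.1.1 σ.2.1 σ.2.2.1 σ.1.2 σ.2.2.2
  choose elem he1 he2 using step
  let succ : St → St := fun σ =>
    ⟨({z | ∀ ε ∈ κ.powerset, φ (wF ε (elem σ)) z ∈ σ.1.1}, elem σ + σ.1.2), by
      refine ⟨?_, ?_, ?_⟩
      · have : {z | ∀ ε ∈ κ.powerset, φ (wF ε (elem σ)) z ∈ σ.1.1}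
            = ⋂ ε ∈ κ.powerset, φ (wF ε (elem σ)) ⁻¹' σ.1.1 := by
          ext z; simp
        simp only [this]
        exact isOpen_biInter_finset fun ε _ => σ.2.1.preimage (hφ.cont _)
      · obtain ⟨u, hu⟩ := he1 σ
        exact ⟨u, fun ε hε => hu ε (Finset.mem_powerset.1 hε)⟩
      · intro z hz ε hε
        simp only [map_add]
        rw [add_comm, hφ.add]
        exact σ.2.2.2 _ (hz ε (Finset.mem_powerset.2 hε)) ε hε⟩
  let σ0 : St := ⟨(U0, 0), hU0, ⟨x, hx⟩, fun z hz ε _ => by simpa [hφ.zero] using hz⟩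
  refine ⟨Stream'.corec elem succ σ0, ?_⟩
  suffices H : ∀ (a : Stream' (ι → ℤ)), ∀ m ∈ Hindman.FS a, ∀ σ, a = Stream'.corec elem succ σ →
      ∃ u, (∀ ε, ε ⊂ κ → φ (wF ε m) u ∈ σ.1.1) ∧ φ (wF κ (m + σ.1.2)) u ∈ V by
    intro m hm
    simpa [σ0] using H _ m hm σ0 rfl
  intro a m h
  induction h with
  | head' b =>
    rintro σ rfl
    rw [Stream'.corec_eq, Stream'.head_cons]
    exact he2 σ
  | tail' b m h ih =>
    rintro σ rfl
    obtain ⟨u, hu1, hu2⟩ := ih (succ σ) (by rw [Stream'.corec_eq, Stream'.tail_cons])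
    refine ⟨φ (wF κ (elem σ)) u, fun ε hε => ?_, ?_⟩
    · have := hu1 ε hε κ (Finset.mem_powerset.2 subset_rfl)
      rw [← hφ.add] at this ⊢
      rwa [add_comm]
    · rw [← hφ.add]
      convert hu2 using 2
      simp only [succ, map_add]; ring
  | cons' b m h ih =>
    rintro σ rfl
    obtain ⟨u, hu1, hu2⟩ := ih (succ σ) (by rw [Stream'.corec_eq, Stream'.tail_cons])
    rw [Stream'.corec_eq, Stream'.head_cons]
    refine ⟨u, fun ε hε => ?_, ?_⟩
    · have := hu1 ε hε ε (Finset.mem_powerset.2 hε.subset)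
      rw [map_add, hφ.add]
      exact this
    · convert hu2 using 2
      simp only [succ, map_add]; ring

/-- The corner lemma. -/
theorem corner {ι : Type*} [DecidableEq ι] (hφ : MDFlow φ) (x w : X) (α : Finset ι)
    (hα : α.Nonempty)
    (p : Ultrafilter (ℤ × (ι → ℤ))) (hp : ∀ ε, ε ⊂ α → Rlim φ (wG ε) p x = x)
    (hpw : Rlim φ (wG α) p x = w) :
    ∃ r : Ultrafilter (ι → ℤ), (∀ ε, ε ⊂ α → Rlim φ (wF ε) r x = x) ∧
      Rlim φ (wF α) r x = w := by
  obtain ⟨j, hjα⟩ := hα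
  obtain ⟨κ, hj, rfl⟩ : ∃ κ, j ∉ κ ∧ insert j κ = α :=
    ⟨α.erase j, Finset.notMem_erase j α, Finset.insert_erase hjα⟩
  have key : ∀ U V : Set X, U ∈ 𝓝 x → V ∈ 𝓝 w → ∃ n : ι → ℤ,
      (∀ ε, ε ⊂ insert j κ → φ (wF ε n) x ∈ U) ∧ φ (wF (insert j κ) n) x ∈ V := by
    intro U V' hU hV'
    obtain ⟨V, hVV', hV, hwV⟩ := mem_nhds_iff.1 hV'
    obtain ⟨U0, hU0, hx, hUU, hO⟩ :=
      corner_open hφ x w (insert j κ) p hp hpw U V hU (hV.mem_nhds hwV)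
    obtain ⟨a, ha⟩ := corner_stream hφ x κ j hj U0 V hU0 hx hV hO
    obtain ⟨e, he, hea⟩ := Hindman.exists_idempotent_ultrafilter_le_FS a
    have ev : ∀ᶠ m in (e : Filter (ι → ℤ)), ∀ ε ∈ κ.powerset, φ (wF ε m) x ∈ U0 := by
      rw [Filter.eventually_all_finset]
      intro ε _
      have hl := Rlim_tendsto φ (wF ε) e x
      rw [Rlim_idem hφ _ _ he] at hl
      exact hl (hU0.mem_nhds hx)
    obtain ⟨m, hm1, hm2⟩ := (ev.and hea).exists
    obtain ⟨u, hu1, hu2⟩ := ha m hm2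
    have hop : IsOpen ((⋂ ε ∈ κ.ssubsets, φ (wF ε m) ⁻¹' U0) ∩ φ (wF κ m) ⁻¹' V) :=
      (isOpen_biInter_finset fun ε _ => hU0.preimage (hφ.cont _)).inter (hV.preimage (hφ.cont _))
    obtain ⟨_, ⟨l, rfl⟩, hl1, hl2⟩ := (hφ.min x).exists_mem_open hop
      ⟨u, by simpa using hu1, hu2⟩
    have hl1' : ∀ ε, ε ⊂ κ → φ (wF ε m) (φ l x) ∈ U0 := by simpa using hl1
    have e1 : ∀ ε, j ∉ ε → wF ε (Function.update m j l) = wF ε m := by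
      intro ε hε
      simp only [wF, AddMonoidHom.coe_mk, ZeroHom.coe_mk]
      exact Finset.sum_congr rfl fun i hi => by
        rw [Function.update_of_ne]; rintro rfl; exact hε hi
    have e2 : ∀ ε, j ∉ ε → wF (insert j ε) (Function.update m j l) = wF ε m + l := by
      intro ε hε
      rw [← e1 ε hε]
      simp only [wF, AddMonoidHom.coe_mk, ZeroHom.coe_mk]
      rw [Finset.sum_insert hε, Function.update_self, add_comm]
    refine ⟨Function.update m j l, fun ε hε => hUU ?_, hVV' ?_⟩
    · by_cases hjε : j ∈ ε
      · obtain ⟨ε', hj', rfl⟩ : ∃ ε', j ∉ ε' ∧ insert j ε' = ε :=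
          ⟨ε.erase j, Finset.notMem_erase j ε, Finset.insert_erase hjε⟩
        rw [e2 _ hj', hφ.add]
        apply hl1'
        refine Finset.ssubset_iff_subset_ne.2 ⟨?_, ?_⟩
        · intro i hi
          have := hε.subset (Finset.mem_insert_of_mem hi)
          refine (Finset.mem_insert.1 this).resolve_left ?_
          rintro rfl; exact hj' hi
        · rintro rfl; exact hε.ne rfl
      · rw [e1 _ hjε]
        refine hm1 ε (Finset.mem_powerset.2 fun i hi => ?_)
        refine (Finset.mem_insert.1 (hε.subset hi)).resolve_left ?_
        rintro rfl; exact hjε hi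
    · rw [e2 _ hj, hφ.add]; exact hl2
  have hfin : Finite {ε : Finset ι // ε ⊂ insert j κ} :=
    Set.Finite.to_subtype ((insert j κ).ssubsets.finite_toSet.subset fun ε hε => by
      simpa using (show ε ⊂ insert j κ from hε))
  obtain ⟨r, -, hr⟩ := exists_Rlim (φ := φ) (M := ι → ℤ)
    (E := Option {ε : Finset ι // ε ⊂ insert j κ})
    (fun e => e.elim (wF (insert j κ)) fun e => wF e.1) (fun _ => x)
    (fun e => e.elim w fun _ => x) (fun _ => True) (by
      intro W hW
      obtain ⟨n, hn1, hn2⟩ := key (⋂ e, W (some e)) (W none)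
        ((Filter.iInter_mem (f := 𝓝 x)).2 fun e => hW (some e)) (hW none)
      refine ⟨n, trivial, ?_⟩
      rintro (_ | e)
      · exact hn2
      · exact Set.mem_iInter.1 (hn1 e.1 e.2) e)
  exact ⟨r, fun ε hε => hr (some ⟨ε, hε⟩), hr none⟩

/-- Restriction of an integer vector to a finite set. -/
def restr {ι : Type*} [DecidableEq ι] (α : Finset ι) (n : ι → ℤ) : ι → ℤ :=
  fun i => if i ∈ α then n i else 0

theorem wF_restr {ι : Type*} [DecidableEq ι] (α ε : Finset ι) (n : ι → ℤ) :
    wF ε (restr α n) = wF (ε ∩ α) n := by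
  simp [wF, restr, Finset.sum_ite_mem]

theorem wG_lift {ι : Type*} (ε : Finset ι) (n : ι → ℤ) : wG ε (0, n) = wF ε n := by
  simp [wF, wG]

/-- Points of the cube space over `x` are limits of face translates of the diagonal. -/
theorem main_abs {ι : Type*} [DecidableEq ι] [Fintype ι] (hφ : MDFlow φ) (x : X)
    (y : Finset ι → X)
    (P : Ultrafilter (ℤ × (ι → ℤ))) (hP : ∀ ε, Rlim φ (wG ε) P x = y ε) (hy : y ∅ = x) :
    ∃ r : Ultrafilter (ι → ℤ), ∀ ε, Rlim φ (wF ε) r x = y ε := by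
  suffices H : ∃ r : Ultrafilter (ι → ℤ), ∀ ε, Rlim φ (wF ε) r (y ε) = x by
    obtain ⟨r, hr⟩ := H
    obtain ⟨q, hq⟩ := Rlim_inv hφ r
    refine ⟨q, fun ε => ?_⟩
    have := (hq (wF ε) (y ε)).1
    rwa [hr] at this
  suffices H : ∀ N : ℕ, ∀ D : Finset (Finset ι), D.card = N →
      (∀ ε ∈ D, ∀ ε' ⊆ ε, ε' ∈ D) →
      ∃ r : Ultrafilter (ι → ℤ), ∀ ε ∈ D, Rlim φ (wF ε) r (y ε) = x by
    obtain ⟨r, hr⟩ := H _ Finset.univ rfl (by simp)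
    exact ⟨r, fun ε => hr ε (Finset.mem_univ _)⟩
  intro N
  induction N with
  | zero =>
    intro D hD _
    rw [Finset.card_eq_zero] at hD
    subst hD
    exact ⟨pure 0, by simp⟩
  | succ N ih =>
    intro D hD hlow
    have hne : D.Nonempty := by rw [← Finset.card_pos]; omega
    obtain ⟨α, hαD, hmax⟩ := Finset.exists_max_image D Finset.card hne
    have hmax' : ∀ ε ∈ D, α ⊆ ε → ε = α := fun ε hε h =>
      (Finset.eq_of_subset_of_card_le h (hmax ε hε)).symm
    obtain ⟨p, hp⟩ := ih (D.erase α) (by rw [Finset.card_erase_of_mem hαD]; omega) (by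
      intro ε hε ε' hε'
      rw [Finset.mem_erase] at hε ⊢
      refine ⟨?_, hlow ε hε.2 ε' hε'⟩
      rintro rfl
      exact hε.1 (hmax' ε hε.2 hε'))
    rcases α.eq_empty_or_nonempty with rfl | hαne
    · refine ⟨p, fun ε hε => ?_⟩
      obtain rfl := hmax' ε hε (Finset.empty_subset _)
      rw [hy]
      apply Rlim_eq
      simp [wF, hφ.zero]
    have hlt : ∀ ε, ε ⊂ α → Rlim φ (wF ε) p (y ε) = x := fun ε hε =>
      hp ε (Finset.mem_erase.2 ⟨hε.ne, hlow α hαD ε hε.subset⟩)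
    have hl : ∀ ε : Finset ι, Rlim φ (wG ε) (p.map (fun n => ((0 : ℤ), n)) + P) x
        = Rlim φ (wF ε) p (y ε) := by
      intro ε
      rw [Rlim_add hφ, hP, Rlim_map]
      simp only [wG_lift]
    obtain ⟨r, hr1, hr2⟩ := corner hφ x (Rlim φ (wF α) p (y α)) α hαne
      (p.map (fun n => ((0 : ℤ), n)) + P) (fun ε hε => by rw [hl, hlt ε hε]) (hl α)
    obtain ⟨q, hq⟩ := Rlim_inv hφ (r.map (restr α))
    have hr' : ∀ ε z, Rlim φ (wF ε) (r.map (restr α)) z = Rlim φ (wF (ε ∩ α)) r z := by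
      intro ε z
      rw [Rlim_map]
      simp only [wF_restr]
    refine ⟨q + p, fun ε hε => ?_⟩
    rw [Rlim_add hφ]
    by_cases hεα : ε = α
    · subst hεα
      rw [← hr2]
      have := (hq (wF ε) x).1
      rwa [hr', Finset.inter_self] at this
    · rw [hp ε (Finset.mem_erase.2 ⟨hεα, hε⟩)]
      have := (hq (wF ε) x).1
      rwa [hr', hr1] at this
      refine Finset.ssubset_iff_subset_ne.2 ⟨Finset.inter_subset_right, fun h => ?_⟩
      exact hεα (hmax' ε hε (Finset.inter_eq_right.1 h))

end flow

/-- The vertex of the cube attached to a finite set. -/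
def vtx {d : ℕ} (s : Finset (Fin d)) : Fin d → Bool := fun i => decide (i ∈ s)

theorem dotP_vtx {d : ℕ} (n : Fin d → ℤ) (s : Finset (Fin d)) : dotP n (vtx s) = wF s n := by
  simp [dotP, vtx, wF]

theorem exists_vtx {d : ℕ} (ε : Fin d → Bool) : ∃ s, vtx s = ε :=
  ⟨Finset.univ.filter (fun i => ε i = true), by funext i; simp [vtx]⟩

theorem dotP_add {d : ℕ} (m n : Fin d → ℤ) (ε : Fin d → Bool) :
    dotP (m + n) ε = dotP m ε + dotP n ε := by
  obtain ⟨s, rfl⟩ := exists_vtx ε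
  simp only [dotP_vtx, map_add]

theorem dotP_zero {d : ℕ} (ε : Fin d → Bool) : dotP (0 : Fin d → ℤ) ε = 0 := by
  obtain ⟨s, rfl⟩ := exists_vtx ε
  simp only [dotP_vtx, map_zero]

theorem dotP_neg {d : ℕ} (n : Fin d → ℤ) (ε : Fin d → Bool) :
    dotP (-n) ε = - dotP n ε := by
  obtain ⟨s, rfl⟩ := exists_vtx ε
  simp only [dotP_vtx, map_neg]

theorem dotP_single {d : ℕ} (j : Fin d) (ε : Fin d → Bool) :
    dotP (Pi.single j 1 : Fin d → ℤ) ε = if ε j then 1 else 0 := by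
  unfold dotP
  rw [Finset.sum_eq_single j]
  · simp
  · intro i _ hi; simp [hi]
  · simp

/-- The face translation with exponent vector `n`. -/
def faceN {X : Type*} (T : Equiv.Perm X) (d : ℕ) (n : Fin d → ℤ) :
    Equiv.Perm ((Fin d → Bool) → X) :=
  Equiv.piCongrRight fun ε => T ^ dotP n ε

theorem faceN_apply {X : Type*} (T : Equiv.Perm X) (d : ℕ) (n : Fin d → ℤ)
    (z : (Fin d → Bool) → X) (ε : Fin d → Bool) : faceN T d n z ε = (T ^ dotP n ε) (z ε) := rfl

theorem faceN_single {X : Type*} (T : Equiv.Perm X) (d : ℕ) (j : Fin d) :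
    faceN T d (Pi.single j 1) = faceT T d j := by
  ext z ε
  rw [faceN_apply, dotP_single]
  by_cases h : ε j = true <;> simp [faceT, h]

theorem faceN_add {X : Type*} (T : Equiv.Perm X) (d : ℕ) (m n : Fin d → ℤ) :
    faceN T d (m + n) = faceN T d m * faceN T d n := by
  ext z ε
  simp only [faceN_apply, Equiv.Perm.mul_apply, dotP_add, zpow_add]

theorem faceN_zero {X : Type*} (T : Equiv.Perm X) (d : ℕ) : faceN T d 0 = 1 := by
  ext z ε
  simp only [faceN_apply, dotP_zero, zpow_zero, Equiv.Perm.one_apply]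

theorem faceN_neg {X : Type*} (T : Equiv.Perm X) (d : ℕ) (n : Fin d → ℤ) :
    faceN T d (-n) = (faceN T d n)⁻¹ := by
  rw [eq_inv_iff_mul_eq_one, ← faceN_add, neg_add_cancel, faceN_zero]

theorem mem_faceGroup {X : Type*} (T : Equiv.Perm X) (d : ℕ)
    (S : Equiv.Perm ((Fin d → Bool) → X)) :
    S ∈ faceGroup T d ↔ ∃ n, S = faceN T d n := by
  constructor
  · intro h
    induction h using Subgroup.closure_induction with
    | mem s hs =>
      obtain ⟨j, rfl⟩ := hs
      exact ⟨_, (faceN_single T d j).symm⟩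
    | one => exact ⟨0, (faceN_zero T d).symm⟩
    | mul a b _ _ ha hb =>
      obtain ⟨m, rfl⟩ := ha
      obtain ⟨n, rfl⟩ := hb
      exact ⟨m + n, (faceN_add T d m n).symm⟩
    | inv a _ ha =>
      obtain ⟨m, rfl⟩ := ha
      exact ⟨-m, (faceN_neg T d m).symm⟩
  · rintro ⟨n, rfl⟩
    let A : AddSubgroup (Fin d → ℤ) :=
      { carrier := {n | faceN T d n ∈ faceGroup T d}
        zero_mem' := by
          show faceN T d 0 ∈ faceGroup T d
          rw [faceN_zero]; exact one_mem _
        add_mem' := by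
          intro a b ha hb
          show faceN T d (a + b) ∈ faceGroup T d
          rw [faceN_add]; exact mul_mem ha hb
        neg_mem' := by
          intro a ha
          show faceN T d (-a) ∈ faceGroup T d
          rw [faceN_neg]; exact inv_mem ha }
    have hs : ∀ j, Pi.single j 1 ∈ A := fun j => by
      show faceN T d (Pi.single j 1) ∈ faceGroup T d
      rw [faceN_single]
      exact Subgroup.subset_closure ⟨j, rfl⟩
    have hn : n ∈ A := by
      have : n = ∑ j, n j • (Pi.single j 1 : Fin d → ℤ) := by
        funext i
        simp [Finset.sum_apply, Pi.single_apply]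
      rw [this]
      exact sum_mem fun j _ => A.zsmul_mem (hs j) _
    exact hn

theorem mdflow_of {X : Type*} [MetricSpace X] (T : X ≃ₜ X)
    (hmin : ∀ x : X, Dense (Set.range fun n : ℤ => (T.toEquiv ^ n) x))
    (hdistal : ∀ x y : X, x ≠ y →
      ∃ δ > 0, ∀ n : ℤ, δ ≤ dist ((T.toEquiv ^ n) x) ((T.toEquiv ^ n) y)) :
    MDFlow (fun n : ℤ => fun x => (T.toEquiv ^ n) x) where
  zero x := by simp
  add m n x := by simp [zpow_add]
  cont n := by
    have hnat : ∀ k : ℕ, Continuous (fun x => (T.toEquiv ^ k) x) := by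
      intro k
      induction k with
      | zero => simpa using continuous_id'
      | succ k ih =>
        simp only [pow_succ, Equiv.Perm.mul_apply]
        exact ih.comp T.continuous
    have hneg : ∀ k : ℕ, Continuous (fun x => (T.toEquiv⁻¹ ^ k) x) := by
      intro k
      induction k with
      | zero => simpa using continuous_id'
      | succ k ih =>
        simp only [pow_succ, Equiv.Perm.mul_apply]
        exact ih.comp T.symm.continuous
    obtain ⟨k, rfl | rfl⟩ := n.eq_nat_or_neg
    · simpa using hnat k
    · simpa using hneg k
  dist := hdistal
  min := hmin

/-- In a minimal distal system, `Q^[d](x)` is the closed `F^[d]`-orbit of `x^[d]`. -/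
theorem cubeQ_fiber_eq_face_orbit
    {X : Type*} [MetricSpace X] [CompactSpace X] (T : X ≃ₜ X) (d : ℕ)
    (hmin : ∀ x : X, Dense (Set.range fun n : ℤ => (T.toEquiv ^ n) x))
    (hdistal : ∀ x y : X, x ≠ y →
      ∃ δ > 0, ∀ n : ℤ, δ ≤ dist ((T.toEquiv ^ n) x) ((T.toEquiv ^ n) y))
    (x : X) :
    {y ∈ cubeQ X T d | y (vertex0 d) = x} =
      closure {w | ∃ S ∈ faceGroup T.toEquiv d, w = S (fun _ => x)} := by
  have hφ := mdflow_of T hmin hdistal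
  ext y
  constructor
  · rintro ⟨hyQ, hy0⟩
    obtain ⟨P, -, hP⟩ := exists_Rlim (φ := fun n : ℤ => fun x => (T.toEquiv ^ n) x)
      (M := ℤ × (Fin d → ℤ)) (E := Finset (Fin d)) (fun s => wG s) (fun _ => x)
      (fun s => y (vtx s)) (fun _ => True) (by
        intro U hU
        have hN : (⋂ s : Finset (Fin d), (fun z : (Fin d → Bool) → X => z (vtx s)) ⁻¹'
            interior (U s)) ∈ 𝓝 y := by
          rw [Filter.iInter_mem]
          intro s
          exact (continuous_apply (vtx s)).continuousAt.preimage_mem_nhds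
            (interior_mem_nhds.2 (hU s))
        obtain ⟨_, hz, z, n, rfl⟩ := mem_closure_iff_nhds.1 hyQ _ hN
        rw [Set.mem_iInter] at hz
        have hop : IsOpen (⋂ s : Finset (Fin d),
            (fun z => (T.toEquiv ^ dotP n (vtx s)) z) ⁻¹' interior (U s)) :=
          isOpen_iInter_of_finite fun s => isOpen_interior.preimage (hφ.cont _)
        obtain ⟨_, ⟨k, rfl⟩, hk⟩ := (hmin x).exists_mem_open hop ⟨z, Set.mem_iInter.2 hz⟩
        refine ⟨(k, n), trivial, fun s => interior_subset ?_⟩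
        have := Set.mem_iInter.1 hk s
        rw [dotP_vtx] at this
        have e : wG s (k, n) = wF s n + k := by simp [wG, wF, add_comm]
        rw [e, zpow_add]
        exact this)
    obtain ⟨r, hr⟩ := main_abs hφ x (fun s => y (vtx s)) P hP (by
      rw [← hy0]; congr 1)
    have ht : Tendsto (fun n : Fin d → ℤ => fun ε => (T.toEquiv ^ dotP n ε) x) r (𝓝 y) := by
      rw [tendsto_pi_nhds]
      intro ε
      obtain ⟨s, rfl⟩ := exists_vtx ε
      have := Rlim_tendsto (fun n : ℤ => fun x => (T.toEquiv ^ n) x) (wF s) r x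
      rw [hr] at this
      simpa only [dotP_vtx] using this
    refine mem_closure_of_tendsto ht (Eventually.of_forall fun n => ?_)
    exact ⟨faceN T.toEquiv d n, (mem_faceGroup _ _ _).2 ⟨n, rfl⟩, rfl⟩
  · intro hy
    refine ⟨closure_mono ?_ hy, ?_⟩
    · rintro _ ⟨S, hS, rfl⟩
      obtain ⟨n, rfl⟩ := (mem_faceGroup _ _ _).1 hS
      exact ⟨x, n, rfl⟩
    · have hcl : IsClosed {z : (Fin d → Bool) → X | z (vertex0 d) = x} :=
        isClosed_eq (continuous_apply _) continuous_const
      refine closure_minimal ?_ hcl hy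
      rintro _ ⟨S, hS, rfl⟩
      obtain ⟨n, rfl⟩ := (mem_faceGroup _ _ _).1 hS
      show (T.toEquiv ^ dotP n (vertex0 d)) x = x
      simp [dotP, vertex0]
end
end

section
/- Let (X,T) be a minimal distal system and d ≥ 1. Then (x,y) ∈ RP^[d](X) if and only if (y, x, x, …, x) ∈ Q^[d+1](X) (with y in the coordinate indexed by ∅ and x in all other coordinates). -/
open Filter Topology

noncomputable section

/-- The regionally proximal relation of order `d`. -/
def RP (X : Type*) [MetricSpace X] (T : X ≃ₜ X) (d : ℕ) : Set (X × X) :=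
  {p | ∀ δ > 0, ∃ (x' y' : X) (n : Fin d → ℤ),
    dist p.1 x' < δ ∧ dist p.2 y' < δ ∧
    ∀ ε : Fin d → Bool, ε ≠ vertex0 d →
      dist ((T.toEquiv ^ dotP n ε) x') ((T.toEquiv ^ dotP n ε) y') < δ}

/-- The point of `X^{2^{d+1}}` with value `a` at the vertex `∅` and given by `b`
elsewhere. -/
def set0 {X : Type*} {d : ℕ} (a : X) (b : (Fin d → Bool) → X) : (Fin d → Bool) → X :=
  fun ε => if ε = vertex0 d then a else b ε

namespace RPaux

/-- Affine integer functions on the cube. -/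
def Aff {D : ℕ} (a : (Fin D → Bool) → ℤ) : Prop :=
  ∃ (m : ℤ) (n : Fin D → ℤ), ∀ ε, a ε = m + dotP n ε

lemma dotP_vertex0 {D : ℕ} (n : Fin D → ℤ) : dotP n (vertex0 D) = 0 := by
  simp [dotP, vertex0]

lemma dotP_zero {D : ℕ} (ε : Fin D → Bool) : dotP (0 : Fin D → ℤ) ε = 0 := by
  simp [dotP]

lemma dotP_add {D : ℕ} (n m : Fin D → ℤ) (ε : Fin D → Bool) :
    dotP (n + m) ε = dotP n ε + dotP m ε := by
  unfold dotP
  rw [← Finset.sum_add_distrib]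
  refine Finset.sum_congr rfl fun i _ => ?_
  split_ifs <;> simp

lemma dotP_single {D : ℕ} (k : Fin D) (z : ℤ) (ε : Fin D → Bool) :
    dotP (Pi.single k z) ε = if ε k then z else 0 := by
  unfold dotP
  rw [Finset.sum_eq_single k]
  · simp
  · intro b _ hb
    simp [Pi.single_eq_of_ne hb]
  · simp

lemma dotP_update {D : ℕ} (n : Fin D → ℤ) (k : Fin D) (b : Bool) (ε : Fin D → Bool) :
    dotP n (Function.update ε k b) =
      (if b then n k else 0) + dotP (n + Pi.single k (- n k)) ε := by
  have h : dotP n (Function.update ε k b) - dotP n ε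
      = (if b then n k else 0) - (if ε k then n k else 0) := by
    unfold dotP
    rw [← Finset.sum_sub_distrib, Finset.sum_eq_single k]
    · simp
    · intro j _ hj
      simp [Function.update_of_ne hj]
    · simp
  rw [dotP_add, dotP_single]
  split_ifs at h ⊢ <;> linarith

lemma dotP_flip {D : ℕ} (n : Fin D → ℤ) (k : Fin D) (ε : Fin D → Bool) :
    dotP n (Function.update ε k (!ε k)) =
      n k + dotP (n + Pi.single k (-2 * n k)) ε := by
  rw [dotP_update, dotP_add, dotP_add, dotP_single, dotP_single]
  cases ε k <;> simp <;> ring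

lemma dotP_succ {d : ℕ} (n : Fin (d + 1) → ℤ) (ε : Fin (d + 1) → Bool) :
    dotP n ε = (if ε 0 then n 0 else 0) + dotP (Fin.tail n) (Fin.tail ε) := by
  unfold dotP
  rw [Fin.sum_univ_succ]
  rfl

lemma Aff.add {D : ℕ} {a b : (Fin D → Bool) → ℤ} (ha : Aff a) (hb : Aff b) :
    Aff (fun ε => a ε + b ε) := by
  obtain ⟨m, n, h⟩ := ha
  obtain ⟨m', n', h'⟩ := hb
  refine ⟨m + m', n + n', fun ε => ?_⟩
  simp only [h, h', dotP_add]
  ring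

lemma Aff.const {D : ℕ} (z : ℤ) : Aff (fun _ : Fin D → Bool => z) :=
  ⟨z, 0, fun ε => by simp [dotP_zero]⟩

/-- Maps of the cube which preserve affine functions. -/
def Good {D : ℕ} (φ : (Fin D → Bool) → (Fin D → Bool)) : Prop :=
  ∀ a, Aff a → Aff (fun ε => a (φ ε))

lemma good_update {D : ℕ} (k : Fin D) (b : Bool) : Good (fun ε => Function.update ε k b) := by
  rintro a ⟨m, n, h⟩
  exact ⟨m + (if b then n k else 0), _, fun ε => by
    change a _ = _
    rw [h, dotP_update, add_assoc]⟩

lemma good_flip {D : ℕ} (k : Fin D) : Good (fun ε => Function.update ε k (!ε k)) := by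
  rintro a ⟨m, n, h⟩
  exact ⟨m + n k, _, fun ε => by
    change a _ = _
    rw [h, dotP_flip, add_assoc]⟩

section
variable {X : Type*} [MetricSpace X] [CompactSpace X] (T : X ≃ₜ X) (D : ℕ)

lemma cont_zpow (n : ℤ) : Continuous (fun x => (T.toEquiv ^ n) x) := by
  induction n using Int.induction_on with
  | zero => exact continuous_id
  | succ i ih =>
    have : (fun x => (T.toEquiv ^ ((i : ℤ) + 1)) x) = fun x => (T.toEquiv ^ (i : ℤ)) (T x) := by
      funext x
      rw [zpow_add_one]
      rfl
    rw [this]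
    exact ih.comp T.continuous
  | pred i ih =>
    have : (fun x => (T.toEquiv ^ (-(i : ℤ) - 1)) x)
        = fun x => (T.toEquiv ^ (-(i : ℤ))) (T.symm x) := by
      funext x
      rw [zpow_sub_one]
      rfl
    rw [this]
    exact ih.comp T.symm.continuous

/-- Action of an integer function. -/
def gen (a : (Fin D → Bool) → ℤ) : (Fin D → Bool) → X → X :=
  fun ε x => (T.toEquiv ^ a ε) x

/-- The enveloping semigroup of the cube group. -/
def Env : Set ((Fin D → Bool) → X → X) := closure {P | ∃ a, Aff a ∧ P = gen T D a}

lemma gen_mem {a : (Fin D → Bool) → ℤ} (ha : Aff a) : gen T D a ∈ Env T D :=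
  subset_closure ⟨a, ha, rfl⟩

lemma env_compact : IsCompact (Env T D) := isClosed_closure.isCompact

lemma one_mem : (fun _ x => x) ∈ Env T D := by
  have := gen_mem T D (Aff.const (D := D) 0)
  exact this

lemma closure_ind {Y Z : Type*} [TopologicalSpace Y] [TopologicalSpace Z] {s : Set Y} {t : Set Z}
    (ht : IsClosed t) {f : Y → Z} (hf : Continuous f) (h : ∀ y ∈ s, f y ∈ t) :
    ∀ y ∈ closure s, f y ∈ t := by
  intro y hy
  exact closure_minimal (t := f ⁻¹' t) h (ht.preimage hf) hy

lemma mul_mem {P Q : (Fin D → Bool) → X → X} (hP : P ∈ Env T D) (hQ : Q ∈ Env T D) :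
    (fun ε x => P ε (Q ε x)) ∈ Env T D := by
  refine closure_ind (t := Env T D) isClosed_closure
    (f := fun P : (Fin D → Bool) → X → X => fun ε x => P ε (Q ε x))
    (by fun_prop) ?_ P hP
  rintro _ ⟨a, ha, rfl⟩
  refine closure_ind (t := Env T D) isClosed_closure
    (f := fun Q : (Fin D → Bool) → X → X => fun ε x => gen T D a ε (Q ε x)) ?_ ?_ Q hQ
  · refine continuous_pi fun ε => continuous_pi fun x => ?_
    exact (cont_zpow T (a ε)).comp (by fun_prop)
  · rintro _ ⟨b, hb, rfl⟩
    have := gen_mem T D (ha.add hb)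
    convert this using 3
    simp [gen, zpow_add]

lemma pull_mem {φ : (Fin D → Bool) → (Fin D → Bool)} (hφ : Good φ)
    {P : (Fin D → Bool) → X → X} (hP : P ∈ Env T D) : (fun ε => P (φ ε)) ∈ Env T D := by
  refine closure_ind (t := Env T D) isClosed_closure
    (f := fun P : (Fin D → Bool) → X → X => fun ε => P (φ ε)) (by fun_prop) ?_ P hP
  rintro _ ⟨a, ha, rfl⟩
  exact gen_mem T D (hφ a ha)

lemma gen_cube {a : (Fin D → Bool) → ℤ} (ha : Aff a) (x : X) :
    (fun ε => (T.toEquiv ^ a ε) x) ∈ cubeQ X T D := by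
  obtain ⟨m, n, h⟩ := ha
  refine subset_closure ⟨(T.toEquiv ^ m) x, n, ?_⟩
  funext ε
  rw [h, add_comm, zpow_add]
  rfl

lemma dotP_aff (n : Fin D → ℤ) : Aff (fun ε => dotP n ε) := ⟨0, n, fun ε => by simp⟩

lemma pull_cube {φ : (Fin D → Bool) → (Fin D → Bool)} (hφ : Good φ)
    {q : (Fin D → Bool) → X} (hq : q ∈ cubeQ X T D) : (fun ε => q (φ ε)) ∈ cubeQ X T D := by
  refine closure_ind (t := cubeQ X T D) isClosed_closure
    (f := fun q : (Fin D → Bool) → X => fun ε => q (φ ε)) (by fun_prop) ?_ q hq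
  rintro _ ⟨x, n, rfl⟩
  exact gen_cube T D (hφ _ (dotP_aff D n)) x

lemma act_cube {P : (Fin D → Bool) → X → X} (hP : P ∈ Env T D)
    {q : (Fin D → Bool) → X} (hq : q ∈ cubeQ X T D) : (fun ε => P ε (q ε)) ∈ cubeQ X T D := by
  refine closure_ind (t := cubeQ X T D) isClosed_closure
    (f := fun P : (Fin D → Bool) → X → X => fun ε => P ε (q ε)) (by fun_prop) ?_ P hP
  rintro _ ⟨a, ha, rfl⟩
  refine closure_ind (t := cubeQ X T D) isClosed_closure
    (f := fun q : (Fin D → Bool) → X => fun ε => gen T D a ε (q ε)) ?_ ?_ q hq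
  · refine continuous_pi fun ε => ?_
    exact (cont_zpow T (a ε)).comp (by fun_prop)
  · rintro _ ⟨x, n, rfl⟩
    have := gen_cube T D (ha.add (dotP_aff D n)) x
    convert this using 2
    simp [gen, zpow_add]

lemma left_inv
    (hdistal : ∀ x y : X, x ≠ y →
      ∃ δ > 0, ∀ n : ℤ, δ ≤ dist ((T.toEquiv ^ n) x) ((T.toEquiv ^ n) y))
    {P : (Fin D → Bool) → X → X} (hP : P ∈ Env T D) :
    ∃ W ∈ Env T D, ∀ ε x, W ε (P ε x) = x := by
  letI : Semigroup ((Fin D → Bool) → X → X) :=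
    { mul := fun P Q ε x => P ε (Q ε x), mul_assoc := fun _ _ _ => rfl }
  have hc : ∀ Q : (Fin D → Bool) → X → X,
      Continuous (fun P : (Fin D → Bool) → X → X => P * Q) := by
    intro Q
    change Continuous (fun P : (Fin D → Bool) → X → X => fun ε x => P ε (Q ε x))
    fun_prop
  obtain ⟨U, ⟨W, hW, hWU⟩, hUU⟩ := exists_idempotent_in_compact_subsemigroup hc
    ((fun R : (Fin D → Bool) → X → X => R * P) '' Env T D)
    (Set.Nonempty.image _ ⟨_, one_mem T D⟩) ((env_compact T D).image (hc P)) (by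
      rintro _ ⟨A, hA, rfl⟩ _ ⟨B, hB, rfl⟩
      have h1 : A * P ∈ Env T D := mul_mem (P := A) (Q := P) T D hA hP
      exact ⟨(A * P) * B, mul_mem (P := A * P) (Q := B) T D h1 hB, rfl⟩)
  refine ⟨W, hW, fun ε x => ?_⟩
  have hU : U ∈ Env T D := by
    rw [← hWU]
    exact mul_mem (P := W) (Q := P) T D hW hP
  have h1 : W ε (P ε x) = U ε x := congrFun (congrFun hWU ε) x
  have h2 : U ε (U ε x) = U ε x := congrFun (congrFun hUU ε) x
  rw [h1]
  by_contra hne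
  obtain ⟨δ, hδ, h⟩ := hdistal _ _ hne
  have h3 : U ∈ {R : (Fin D → Bool) → X → X | δ ≤ dist (R ε (U ε x)) (R ε x)} := by
    refine closure_minimal ?_ (isClosed_le (by fun_prop) (by fun_prop)) hU
    rintro _ ⟨a, _, rfl⟩
    exact h _
  have h4 : δ ≤ dist (U ε (U ε x)) (U ε x) := h3
  rw [h2, dist_self] at h4
  linarith

lemma two_inv
    (hdistal : ∀ x y : X, x ≠ y →
      ∃ δ > 0, ∀ n : ℤ, δ ≤ dist ((T.toEquiv ^ n) x) ((T.toEquiv ^ n) y))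
    {P : (Fin D → Bool) → X → X} (hP : P ∈ Env T D) :
    ∃ W ∈ Env T D, (∀ ε x, W ε (P ε x) = x) ∧ ∀ ε x, P ε (W ε x) = x := by
  obtain ⟨W, hW, h⟩ := left_inv T D hdistal hP
  obtain ⟨V, hV, h'⟩ := left_inv T D hdistal hW
  refine ⟨W, hW, h, fun ε x => ?_⟩
  have := h' ε (P ε (W ε x))
  rw [h, h'] at this
  exact this.symm

lemma exists_env (hmin : ∀ x : X, Dense (Set.range fun n : ℤ => (T.toEquiv ^ n) x)) (x : X)
    {q : (Fin D → Bool) → X} (hq : q ∈ cubeQ X T D) :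
    ∃ P ∈ Env T D, ∀ ε, P ε x = q ε := by
  have hcl : IsClosed ((fun (P : (Fin D → Bool) → X → X) ε => P ε x) '' Env T D) :=
    ((env_compact T D).image (by fun_prop)).isClosed
  have : q ∈ (fun (P : (Fin D → Bool) → X → X) ε => P ε x) '' Env T D := by
    refine closure_minimal ?_ hcl hq
    rintro _ ⟨z, n, rfl⟩
    refine closure_ind hcl (f := fun z ε => (T.toEquiv ^ dotP n ε) z)
      (continuous_pi fun ε => cont_zpow T _) ?_ z (hmin x z)
    rintro _ ⟨m, rfl⟩
    refine ⟨_, gen_mem T D ((dotP_aff D n).add (Aff.const m)), ?_⟩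
    funext ε
    simp [gen, zpow_add]
  obtain ⟨P, hP, h⟩ := this
  exact ⟨P, hP, fun ε => congrFun h ε⟩

lemma glue (hmin : ∀ x : X, Dense (Set.range fun n : ℤ => (T.toEquiv ^ n) x))
    (hdistal : ∀ x y : X, x ≠ y →
      ∃ δ > 0, ∀ n : ℤ, δ ≤ dist ((T.toEquiv ^ n) x) ((T.toEquiv ^ n) y))
    {u v : (Fin D → Bool) → X} (hu : u ∈ cubeQ X T D) (hv : v ∈ cubeQ X T D) (k : Fin D)
    (huv : ∀ ε, ε k = true → u ε = v ε) :
    (fun ε => if ε k then v (Function.update ε k false) else u ε) ∈ cubeQ X T D := by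
  have hq1 := pull_cube T D (good_update k true) hu
  have hq2 := pull_cube T D (good_flip k) hv
  obtain ⟨P1, hP1, h1⟩ := exists_env T D hmin (u (vertex0 D)) hq1
  obtain ⟨P2, hP2, h2⟩ := exists_env T D hmin (u (vertex0 D)) hq2
  obtain ⟨W1, hW1, h3⟩ := left_inv T D hdistal hP1
  obtain ⟨P, hP, hPq⟩ : ∃ P ∈ Env T D, ∀ ε, P ε (u (Function.update ε k true))
      = v (Function.update ε k (!ε k)) :=
    ⟨_, mul_mem T D hP2 hW1, fun ε => by
      have a := h1 ε
      have b := h2 ε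
      rw [← a, h3, b]⟩
  obtain ⟨W, hW, hl, hr⟩ := two_inv T D hdistal (pull_mem T D (good_update k false) hP)
  have := act_cube T D (mul_mem T D hP hW) hu
  convert this using 2 with ε
  by_cases hk : ε k = true
  · have e1 : Function.update ε k true = ε := by rw [← hk, Function.update_eq_self]
    have a := hPq (Function.update ε k false)
    simp only [Function.update_idem, Function.update_self, Bool.not_false, e1] at a
    rw [← huv ε hk] at a
    have b := hl ε (u ε)
    simp only [a] at b
    have c := hPq ε
    rw [e1, hk] at c
    rw [if_pos hk, b, c]
    rfl
  · have hk' : ε k = false := by simpa using hk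
    have e1 : Function.update ε k false = ε := by rw [← hk', Function.update_eq_self]
    have a := hr ε (u ε)
    simp only [e1] at a
    rw [if_neg hk, a]

end

section
variable {X : Type*} [MetricSpace X] [CompactSpace X] (T : X ≃ₜ X) (d : ℕ)

lemma tail_v0 : Fin.tail (vertex0 (d + 1)) = vertex0 d := rfl

lemma eq_of_tail {ε : Fin (d + 1) → Bool} (h : Fin.tail ε = vertex0 d) (h0 : ε 0 = false) :
    ε = vertex0 (d + 1) := by
  funext i
  refine Fin.cases h0 (fun j => congrFun h j) i

lemma reduce (hmin : ∀ x : X, Dense (Set.range fun n : ℤ => (T.toEquiv ^ n) x))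
    (hdistal : ∀ x y : X, x ≠ y →
      ∃ δ > 0, ∀ n : ℤ, δ ≤ dist ((T.toEquiv ^ n) x) ((T.toEquiv ^ n) y))
    (x y : X) (c : (Fin (d + 1) → Bool) → X) (hc : c ∈ cubeQ X T (d + 1))
    (hx : c (vertex0 (d + 1)) = x) (hy : c (Function.update (vertex0 (d + 1)) 0 true) = y)
    (hi : ∀ ε, Fin.tail ε ≠ vertex0 d → c ε = c (Function.update ε 0 false))
    (s : Finset (Fin d)) :
    ∃ c ∈ cubeQ X T (d + 1), c (vertex0 (d + 1)) = x ∧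
      c (Function.update (vertex0 (d + 1)) 0 true) = y ∧
      (∀ ε, Fin.tail ε ≠ vertex0 d → c ε = c (Function.update ε 0 false)) ∧
      (∀ ε, Fin.tail ε ≠ vertex0 d → (∀ i, ε (Fin.succ i) = true → i ∈ s) → c ε = x) := by
  induction s using Finset.induction_on with
  | empty =>
    refine ⟨c, hc, hx, hy, hi, fun ε h h' => ?_⟩
    exfalso
    apply h
    funext i
    have := h' i
    simpa [Fin.tail, vertex0] using this
  | insert k s _ ih =>
    clear hi hx hy hc c
    obtain ⟨c, hc, hx, hy, hi, hs⟩ := ih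
    have hk0 : Fin.succ k ≠ 0 := Fin.succ_ne_zero k
    have ht : ∀ ε : Fin (d + 1) → Bool, ε k.succ = true → Fin.tail ε ≠ vertex0 d := by
      intro ε h h'
      have := congrFun h' k
      simp [Fin.tail, vertex0, h] at this
    refine ⟨_, glue T (d + 1) hmin hdistal hc (pull_cube T (d + 1) (good_update 0 false) hc)
      k.succ (fun ε h => hi ε (ht ε h)), ?_, ?_, ?_, ?_⟩
    · simpa [vertex0] using hx
    · simpa [vertex0, hk0] using hy
    · intro ε h
      by_cases hk : ε k.succ = true
      · simp only [Function.update_of_ne hk0, hk, if_true]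
        rw [Function.update_comm hk0.symm, Function.update_idem]
      · simp only [Function.update_of_ne hk0, hk]
        simpa using hi ε h
    · intro ε h hsub
      by_cases hk : ε k.succ = true
      · simp only [hk, if_true]
        set ε' := Function.update (Function.update ε k.succ false) 0 false with hε'
        by_cases h0 : Fin.tail ε' = vertex0 d
        · rw [eq_of_tail d h0 (by simp [hε']), hx]
        · refine hs _ h0 fun i hi' => ?_
          rw [hε', Function.update_of_ne (Fin.succ_ne_zero i)] at hi'
          by_cases hik : i = k
          · subst hik
            simp at hi'
          · rw [Function.update_of_ne (by simpa using hik)] at hi'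
            exact Finset.mem_of_mem_insert_of_ne (hsub i hi') hik
      · simp only [hk]
        refine hs ε h fun i hi' => ?_
        refine Finset.mem_of_mem_insert_of_ne (hsub i hi') ?_
        rintro rfl
        exact hk hi'

lemma approx (hmin : ∀ x : X, Dense (Set.range fun n : ℤ => (T.toEquiv ^ n) x))
    (x y : X) (h : (x, y) ∈ RP X T d) (δ : ℝ) (hδ : 0 < δ) :
    ∃ c ∈ cubeQ X T (d + 1), dist (c (vertex0 (d + 1))) x < δ ∧
      dist (c (Function.update (vertex0 (d + 1)) 0 true)) y < δ ∧
      (∀ ε, Fin.tail ε ≠ vertex0 d → dist (c ε) (c (Function.update ε 0 false)) < δ) := by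
  obtain ⟨x', y', n, h1, h2, h3⟩ := h (δ / 2) (half_pos hδ)
  have hopen : IsOpen {z : X | ∀ ε, dist ((T.toEquiv ^ dotP n ε) z) ((T.toEquiv ^ dotP n ε) y')
      < δ / 2} := by
    rw [Set.setOf_forall]
    exact isOpen_iInter_of_finite fun ε =>
      isOpen_lt ((cont_zpow T _).dist continuous_const) continuous_const
  obtain ⟨_, hz, m, rfl⟩ := (hmin x').inter_open_nonempty _ hopen
    ⟨y', fun ε => by simpa using half_pos hδ⟩
  simp only [Set.mem_setOf_eq] at hz
  have key : ∀ ε : Fin (d + 1) → Bool,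
      (T.toEquiv ^ dotP (Fin.cons m n : Fin (d + 1) → ℤ) ε) x' =
      (T.toEquiv ^ dotP n (Fin.tail ε)) (if ε 0 then (T.toEquiv ^ m) x' else x') := by
    intro ε
    rw [dotP_succ, Fin.cons_zero, Fin.tail_cons, add_comm, zpow_add]
    by_cases h : ε 0 = true <;> simp [h]
  have tu : ∀ (ε : Fin (d + 1) → Bool) b, Fin.tail (Function.update ε 0 b) = Fin.tail ε := by
    intro ε b
    funext i
    simp [Fin.tail]
  refine ⟨_, gen_cube T (d + 1) (dotP_aff (d + 1) (Fin.cons m n)) x', ?_, ?_, ?_⟩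
  · simp only [dotP_vertex0, zpow_zero, Equiv.Perm.coe_one, id]
    rw [dist_comm]
    exact h1.trans (half_lt_self hδ)
  · have a := hz (vertex0 d)
    simp only [key, tu, tail_v0, Function.update_self, if_true]
    simp only [dotP_vertex0, zpow_zero, Equiv.Perm.coe_one, id] at a ⊢
    have b := dist_triangle ((T.toEquiv ^ m) x') y' y
    have c : dist y y' < δ / 2 := h2
    rw [dist_comm y y'] at c
    linarith
  · intro ε hε
    have a := hz (Fin.tail ε)
    have b := h3 (Fin.tail ε) hε
    simp only [key, tu, Function.update_self]
    by_cases h0 : ε 0 = true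
    · simp only [h0, if_true]
      have c := dist_triangle_right ((T.toEquiv ^ dotP n (Fin.tail ε)) ((T.toEquiv ^ m) x'))
        ((T.toEquiv ^ dotP n (Fin.tail ε)) x') ((T.toEquiv ^ dotP n (Fin.tail ε)) y')
      simp only [Bool.false_eq_true, if_false]
      linarith
    · simp [h0, hδ]

lemma limit (hmin : ∀ x : X, Dense (Set.range fun n : ℤ => (T.toEquiv ^ n) x))
    (x y : X) (h : (x, y) ∈ RP X T d) :
    ∃ c ∈ cubeQ X T (d + 1), c (vertex0 (d + 1)) = x ∧
      c (Function.update (vertex0 (d + 1)) 0 true) = y ∧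
      (∀ ε, Fin.tail ε ≠ vertex0 d → c ε = c (Function.update ε 0 false)) := by
  have hpos : ∀ k : ℕ, (0 : ℝ) < 1 / ((k : ℝ) + 1) := fun k => by positivity
  choose c hc h1 h2 h3 using fun k : ℕ => approx T d hmin x y h _ (hpos k)
  have hcomp : IsCompact (cubeQ X T (d + 1)) := isClosed_closure.isCompact
  obtain ⟨c0, hc0, φ, hφ, hlim⟩ := hcomp.tendsto_subseq hc
  have hl : ∀ ε, Tendsto (fun k => c (φ k) ε) atTop (𝓝 (c0 ε)) := fun ε =>
    (tendsto_pi_nhds.1 hlim) ε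
  have hz : Tendsto (fun k => 1 / ((φ k : ℝ) + 1)) atTop (𝓝 0) :=
    tendsto_one_div_add_atTop_nhds_zero_nat.comp hφ.tendsto_atTop
  refine ⟨c0, hc0, ?_, ?_, fun ε hε => ?_⟩
  · exact dist_le_zero.1 (le_of_tendsto_of_tendsto' ((hl _).dist tendsto_const_nhds) hz
      fun k => (h1 (φ k)).le)
  · exact dist_le_zero.1 (le_of_tendsto_of_tendsto' ((hl _).dist tendsto_const_nhds) hz
      fun k => (h2 (φ k)).le)
  · exact dist_le_zero.1 (le_of_tendsto_of_tendsto' ((hl _).dist (hl _)) hz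
      fun k => (h3 (φ k) ε hε).le)

lemma backward (x y : X)
    (h : set0 y (fun _ : Fin (d + 1) → Bool => x) ∈ cubeQ X T (d + 1)) : (x, y) ∈ RP X T d := by
  intro δ hδ
  obtain ⟨_, ⟨z, n, rfl⟩, hd⟩ := Metric.mem_closure_iff.1 h (δ / 2) (half_pos hδ)
  rw [dist_pi_lt_iff (half_pos hδ)] at hd
  have key : ∀ (b : Bool) (ε : Fin d → Bool), (b = true ∨ ε ≠ vertex0 d) →
      dist x ((T.toEquiv ^ dotP (Fin.tail n) ε) ((T.toEquiv ^ (if b then n 0 else 0)) z))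
        < δ / 2 := by
    intro b ε hb
    have a := hd (Fin.cons b ε)
    rw [dotP_succ, Fin.cons_zero, Fin.tail_cons, add_comm (ite _ _ _), zpow_add] at a
    have hne : (Fin.cons b ε : Fin (d + 1) → Bool) ≠ vertex0 (d + 1) := by
      intro he
      rcases hb with hb | hb
      · have := congrFun he 0
        simp [vertex0, hb] at this
      · exact hb (by rw [← tail_v0, ← he, Fin.tail_cons])
    rw [set0, if_neg hne] at a
    exact a
  refine ⟨(T.toEquiv ^ n 0) z, z, Fin.tail n, ?_, ?_, fun ε hε => ?_⟩
  · have := key true (vertex0 d) (Or.inl rfl)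
    simp only [dotP_vertex0, zpow_zero, Equiv.Perm.coe_one, id, if_true] at this
    exact this.trans (half_lt_self hδ)
  · have := hd (vertex0 (d + 1))
    simp only [dotP_vertex0, zpow_zero, Equiv.Perm.coe_one, id, set0, if_true] at this
    exact this.trans (half_lt_self hδ)
  · have a := key true ε (Or.inl rfl)
    have b := key false ε (Or.inr hε)
    simp only [if_true] at a
    simp only [Bool.false_eq_true, if_false, zpow_zero, Equiv.Perm.coe_one, id] at b
    have c := dist_triangle_left ((T.toEquiv ^ dotP (Fin.tail n) ε) ((T.toEquiv ^ n 0) z))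
      ((T.toEquiv ^ dotP (Fin.tail n) ε) z) x
    linarith

end

end RPaux

/-- In a minimal distal system, `(x,y) ∈ RP^[d]` iff `(y,x,…,x) ∈ Q^[d+1]`. -/
theorem RP_iff_set0_mem_cubeQ
    {X : Type*} [MetricSpace X] [CompactSpace X] (T : X ≃ₜ X) (d : ℕ) (hd : 1 ≤ d)
    (hmin : ∀ x : X, Dense (Set.range fun n : ℤ => (T.toEquiv ^ n) x))
    (hdistal : ∀ x y : X, x ≠ y →
      ∃ δ > 0, ∀ n : ℤ, δ ≤ dist ((T.toEquiv ^ n) x) ((T.toEquiv ^ n) y))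
    (x y : X) :
    (x, y) ∈ RP X T d ↔
      set0 y (fun _ : Fin (d + 1) → Bool => x) ∈ cubeQ X T (d + 1) := by
  refine ⟨fun h => ?_, RPaux.backward T d x y⟩
  obtain ⟨c, hc, hx, hy, hi⟩ := RPaux.limit T d hmin x y h
  obtain ⟨c, hc, hx, hy, hi, hs⟩ :=
    RPaux.reduce T d hmin hdistal x y c hc hx hy hi Finset.univ
  have := RPaux.pull_cube T (d + 1) (RPaux.good_flip 0) hc
  convert this using 1
  funext ε
  have tu : ∀ b, Fin.tail (Function.update ε 0 b) = Fin.tail ε := by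
    intro b
    funext i
    simp [Fin.tail]
  by_cases h0 : Fin.tail ε = vertex0 d
  · by_cases hb : ε 0 = true
    · have hne : ε ≠ vertex0 (d + 1) := by
        rintro rfl
        simp [vertex0] at hb
      have he : Function.update ε 0 (!ε 0) = vertex0 (d + 1) :=
        RPaux.eq_of_tail d (by rw [tu, h0]) (by simp [hb])
      rw [set0, if_neg hne, he, hx]
    · have hb' : ε 0 = false := by simpa using hb
      have he := RPaux.eq_of_tail d h0 hb'
      subst he
      rw [set0, if_pos rfl, hb', Bool.not_false, hy]
  · have hne : ε ≠ vertex0 (d + 1) := by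
      rintro rfl
      exact h0 rfl
    rw [set0, if_neg hne]
    exact (hs _ (by rwa [tu]) (fun i _ => Finset.mem_univ i)).symm
end
end
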